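/- arXiv:2109.00933 — 2 statements merged into one kernel-verified Lean document; each statement's English description precedes it below -/
import Mathlib

section
/- Let 𝒜 and ℬ be abelian categories with enough projectives and injectives, T : ℬ → 𝒜 a right exact functor, (𝒳,𝒲) a strong left Frobenius pair in 𝒜 and (𝒴,𝒱) a strong left Frobenius pair in ℬ, with T(V) ∈ 𝒲̂ for every V ∈ 𝒱, T(Y) ∈ 𝒳̂ for every Y ∈ 𝒴, and (L_nT)(Y) = 0 for every Y ∈ 𝒴 and every n ≥ 1. Then for every (W,V,ψ) ∈ 𝔅^𝒲_𝒱 and every (X,Y,φ) ∈ 𝔅^𝒳_𝒴 one has Ext^i_{(T↓𝒜)}((W,V,ψ), (X,Y,φ)) = 0 for all i ≥ 1; that is, 𝔅^𝒲_𝒱 ⊆ ^⊥(𝔅^𝒳_𝒴). -/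
/-!
Formalization of a statement from "Recollements induced by left Frobenius pairs"
(Ma, Sun, Zhu, Hu). Auxiliary definitions (left Frobenius pairs, the classes
`𝒳̂` and `𝔅^𝒳_𝒴`, etc.) are given first; the statement itself is the final theorem.
-/

noncomputable section
namespace Paper
open CategoryTheory CategoryTheory.Limits ZeroObject

universe w₁ w₂ w₃ v v' u u'

section Core
variable {𝒜 : Type u} [Category.{v} 𝒜] [Abelian 𝒜]

/-- `C` is isomorphic to some member of the class `𝒳`. -/
def MemIso (𝒳 : Set 𝒜) (C : 𝒜) : Prop := ∃ X ∈ 𝒳, Nonempty (X ≅ C)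

/-- `C` admits an exact resolution `0 → X_n → ⋯ → X_0 → C → 0` with all `X_i ∈ 𝒳`. -/
def HasResolutionOfLength (𝒳 : Set 𝒜) : ℕ → 𝒜 → Prop
  | 0, C => MemIso 𝒳 C
  | (n+1), C => ∃ S : ShortComplex 𝒜, S.ShortExact ∧ S.X₃ = C ∧ S.X₂ ∈ 𝒳 ∧
      HasResolutionOfLength 𝒳 n S.X₁

/-- The class `𝒳̂` of objects admitting a finite exact resolution by objects of `𝒳`. -/
def Hat (𝒳 : Set 𝒜) : Set 𝒜 := {C | ∃ n, HasResolutionOfLength 𝒳 n C}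

variable [HasExt.{w₁} 𝒜]

/-- `(𝒳, 𝒲)` is a left Frobenius pair in the abelian category `𝒜`:
`𝒳` is closed under extensions, kernels of epimorphisms and direct summands,
`𝒲` is closed under direct summands, `𝒲 ⊆ 𝒳 ∩ 𝒳^⊥`, and every `X ∈ 𝒳` admits a
short exact sequence `0 → X → W → X' → 0` with `W ∈ 𝒲`, `X' ∈ 𝒳`. -/
structure IsLeftFrobeniusPair (𝒳 𝒲 : Set 𝒜) : Prop where
  closed_extensions : ∀ S : ShortComplex 𝒜, S.ShortExact → S.X₁ ∈ 𝒳 → S.X₃ ∈ 𝒳 → S.X₂ ∈ 𝒳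
  closed_kernels_of_epis : ∀ S : ShortComplex 𝒜, S.ShortExact → S.X₂ ∈ 𝒳 → S.X₃ ∈ 𝒳 → S.X₁ ∈ 𝒳
  closed_summands_X : ∀ C A B : 𝒜, C ∈ 𝒳 → Nonempty (C ≅ A ⊞ B) → A ∈ 𝒳
  closed_summands_W : ∀ C A B : 𝒜, C ∈ 𝒲 → Nonempty (C ≅ A ⊞ B) → A ∈ 𝒲
  W_subset_X : 𝒲 ⊆ 𝒳
  W_subset_rightPerp : ∀ W ∈ 𝒲, ∀ X ∈ 𝒳, ∀ i : ℕ, 1 ≤ i → Subsingleton (Abelian.Ext X W i)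
  cogenerator : ∀ X ∈ 𝒳, ∃ S : ShortComplex 𝒜, S.ShortExact ∧ S.X₁ = X ∧ S.X₂ ∈ 𝒲 ∧ S.X₃ ∈ 𝒳

/-- `(𝒳, 𝒲)` is a strong left Frobenius pair: a left Frobenius pair such that moreover
`𝒲 ⊆ ^⊥𝒳` and every `X ∈ 𝒳` admits a short exact sequence `0 → X' → W → X → 0`
with `W ∈ 𝒲`, `X' ∈ 𝒳`. -/
structure IsStrongLeftFrobeniusPair (𝒳 𝒲 : Set 𝒜) extends IsLeftFrobeniusPair 𝒳 𝒲 : Prop where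
  W_subset_leftPerp : ∀ W ∈ 𝒲, ∀ X ∈ 𝒳, ∀ i : ℕ, 1 ≤ i → Subsingleton (Abelian.Ext W X i)
  generator : ∀ X ∈ 𝒳, ∃ S : ShortComplex 𝒜, S.ShortExact ∧ S.X₃ = X ∧ S.X₂ ∈ 𝒲 ∧ S.X₁ ∈ 𝒳

end Core

section CommaDefs
variable {𝒜 : Type u} [Category.{v} 𝒜] [Abelian 𝒜]
  {ℬ : Type u'} [Category.{v'} ℬ] [Abelian ℬ] (T : ℬ ⥤ 𝒜)

/-- The class `𝔅^𝒳_𝒴` in the comma category `(T ↓ 𝒜)`, consisting of the objects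
`(X, Y, φ : T Y ⟶ X)` with `Y ∈ 𝒴`, `φ` a monomorphism and `Coker φ ∈ 𝒳`. -/
def CommaClass (𝒳 : Set 𝒜) (𝒴 : Set ℬ) : Set (Comma T (𝟭 𝒜)) :=
  {Z | Z.left ∈ 𝒴 ∧ Mono Z.hom ∧ MemIso 𝒳 (cokernel Z.hom)}

end CommaDefs

end Paper

open CategoryTheory CategoryTheory.Limits ZeroObject Paper

universe w₁ w₂ w₃ v v' u u'

namespace Paper

section ExtVanishing
variable {C : Type u} [Category.{v} C] [Abelian C] [HasExt.{w₁} C]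

lemma subsingleton_ext_X₂ {S : ShortComplex C} (hS : S.ShortExact) {M : C} {i : ℕ}
    (h₁ : Subsingleton (Abelian.Ext S.X₁ M i)) (h₃ : Subsingleton (Abelian.Ext S.X₃ M i)) :
    Subsingleton (Abelian.Ext S.X₂ M i) := by
  refine subsingleton_of_forall_eq 0 fun x => ?_
  obtain ⟨y, rfl⟩ := Abelian.Ext.contravariant_sequence_exact₂ hS M x (Subsingleton.elim _ _)
  rw [Subsingleton.elim y 0, Abelian.Ext.comp_zero]

lemma subsingleton_ext_to_X₂ {S : ShortComplex C} (hS : S.ShortExact) {M : C} {i : ℕ}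
    (h₁ : Subsingleton (Abelian.Ext M S.X₁ i)) (h₃ : Subsingleton (Abelian.Ext M S.X₃ i)) :
    Subsingleton (Abelian.Ext M S.X₂ i) := by
  refine subsingleton_of_forall_eq 0 fun x => ?_
  obtain ⟨y, rfl⟩ := Abelian.Ext.covariant_sequence_exact₂ M hS x (Subsingleton.elim _ _)
  rw [Subsingleton.elim y 0, Abelian.Ext.zero_comp]

lemma subsingleton_ext_of_iso {M N N' : C} (e : N ≅ N') {i : ℕ}
    (h : Subsingleton (Abelian.Ext M N i)) : Subsingleton (Abelian.Ext M N' i) := by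
  refine subsingleton_of_forall_eq 0 fun x => ?_
  have hx : x = (x.comp (Abelian.Ext.mk₀ e.inv) (add_zero i)).comp
      (Abelian.Ext.mk₀ e.hom) (add_zero i) := by simp
  rw [hx, Subsingleton.elim (x.comp (Abelian.Ext.mk₀ e.inv) (add_zero i)) 0,
    Abelian.Ext.zero_comp]

/-- An object which is left orthogonal to a class is left orthogonal to all objects with
a finite resolution by this class. -/
lemma subsingleton_ext_of_mem_hat {𝒳 : Set C} {M : C}
    (hM : ∀ X ∈ 𝒳, ∀ i : ℕ, 1 ≤ i → Subsingleton (Abelian.Ext M X i)) {N : C} (hN : N ∈ Hat 𝒳)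
    {i : ℕ} (hi : 1 ≤ i) : Subsingleton (Abelian.Ext M N i) := by
  obtain ⟨n, hn⟩ := hN
  induction n generalizing N i with
  | zero =>
    obtain ⟨X, hX, ⟨e⟩⟩ := hn
    exact subsingleton_ext_of_iso e (hM X hX i hi)
  | succ n ih =>
    obtain ⟨S, hS, rfl, h₂, h₁⟩ := hn
    have := hM _ h₂ i hi
    have := ih (i := i + 1) (by lia) h₁
    refine subsingleton_of_forall_eq 0 fun x => ?_
    obtain ⟨y, rfl⟩ := Abelian.Ext.covariant_sequence_exact₃ M hS x rfl (Subsingleton.elim _ _)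
    rw [Subsingleton.elim y 0, Abelian.Ext.zero_comp]

variable {D : Type u'} [Category.{v'} D] [Abelian D] [HasExt.{w₂} D]

/-- Dimension shifting along an adjunction `F ⊣ R`, for a class of objects having projective
presentations within the class which `F` maps to short exact sequences. -/
lemma subsingleton_ext_of_adjunction {F : C ⥤ D} {R : D ⥤ C} (adj : F ⊣ R)
    [F.PreservesZeroMorphisms] [R.PreservesEpimorphisms] {Q : C → Prop}
    (hQ : ∀ V, Q V → ∃ S : ShortComplex C, S.ShortExact ∧ S.X₃ = V ∧ Projective S.X₂ ∧
      Q S.X₁ ∧ (S.map F).ShortExact)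
    (Z : D) {V : C} (hV : Q V)
    (h : ∀ i : ℕ, 1 ≤ i → Subsingleton (Abelian.Ext V (R.obj Z) i)) {i : ℕ} (hi : 1 ≤ i) :
    Subsingleton (Abelian.Ext (F.obj V) Z i) := by
  obtain ⟨i, rfl⟩ := Nat.exists_eq_add_of_le hi
  clear hi
  induction i generalizing V with
  | zero =>
    obtain ⟨S, hS, rfl, hP, -, hF⟩ := hQ V hV
    have : Projective (S.map F).X₂ := adj.map_projective _ hP
    have := h 1 le_rfl
    refine subsingleton_of_forall_eq 0 fun (x : Abelian.Ext (S.map F).X₃ Z 1) => ?_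
    obtain ⟨y, rfl⟩ := Abelian.Ext.contravariant_sequence_exact₃ hF Z x
      (Abelian.Ext.eq_zero_of_projective _) (add_zero 1)
    obtain ⟨f, rfl⟩ := (Abelian.Ext.mk₀_bijective _ _).2 y
    obtain ⟨g, hg⟩ := Abelian.Ext.contravariant_sequence_exact₁ hS (R.obj Z)
      (Abelian.Ext.mk₀ (adj.homEquiv _ _ f)) (add_zero 1) (Subsingleton.elim _ _)
    obtain ⟨g, rfl⟩ := (Abelian.Ext.mk₀_bijective _ _).2 g
    rw [Abelian.Ext.mk₀_comp_mk₀] at hg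
    let g' : (S.map F).X₂ ⟶ Z := (adj.homEquiv _ _).symm g
    have hf : (S.map F).f ≫ g' = f := by
      have hfg := (Abelian.Ext.mk₀_bijective _ _).1 hg
      exact (adj.homEquiv_naturality_left_symm S.f g).symm.trans
        ((congrArg _ hfg).trans (Equiv.symm_apply_apply _ _))
    rw [← hf, ← Abelian.Ext.mk₀_comp_mk₀, hF.extClass_comp_assoc]
    rfl
  | succ i ih =>
    obtain ⟨S, hS, rfl, hP, h₁, hF⟩ := hQ V hV
    have : Projective (S.map F).X₂ := adj.map_projective _ hP
    have hK : ∀ j : ℕ, 1 ≤ j → Subsingleton (Abelian.Ext S.X₁ (R.obj Z) j) := by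
      intro j hj
      obtain ⟨j, rfl⟩ := Nat.exists_eq_add_of_le' hj
      have := h (1 + (j + 1)) (by lia)
      refine subsingleton_of_forall_eq 0 fun x => ?_
      obtain ⟨y, rfl⟩ := Abelian.Ext.contravariant_sequence_exact₁ hS (R.obj Z) x rfl
        (Subsingleton.elim _ _)
      rw [Abelian.Ext.eq_zero_of_projective y, Abelian.Ext.comp_zero]
    have : Subsingleton (Abelian.Ext (S.map F).X₁ Z (i + 1)) := by
      rw [add_comm]
      exact ih h₁ hK
    refine subsingleton_of_forall_eq 0 fun (x : Abelian.Ext (S.map F).X₃ Z (1 + (i + 1))) => ?_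
    obtain ⟨y, rfl⟩ := Abelian.Ext.contravariant_sequence_exact₃ hF Z x
      (Abelian.Ext.eq_zero_of_projective (n := 1 + i) _) rfl
    rw [Subsingleton.elim y 0, Abelian.Ext.comp_zero]
    rfl

end ExtVanishing

section Syzygies
variable {𝒜 : Type u} [Category.{v} 𝒜] [Abelian 𝒜]
  {ℬ : Type u'} [Category.{v'} ℬ] [Abelian ℬ]

/-- `V` is a syzygy of the chain complex `P`, i.e. the cokernel of one of its differentials. -/
def IsSyzygy (P : ChainComplex ℬ ℕ) (V : ℬ) : Prop :=
  ∃ (n : ℕ) (p : P.X n ⟶ V) (w : P.d (n + 1) n ≫ p = 0), Epi p ∧ (ShortComplex.mk _ _ w).Exact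

lemma IsSyzygy.exists_shortExact (T : ℬ ⥤ 𝒜) [T.Additive] [PreservesFiniteColimits T]
    {P : ChainComplex ℬ ℕ}
    (hP : ∀ n, (ShortComplex.mk _ _ (P.d_comp_d (n + 2) (n + 1) n)).Exact)
    (hTP : ∀ n, ((ShortComplex.mk _ _ (P.d_comp_d (n + 2) (n + 1) n)).map T).Exact) {V : ℬ} (hV : IsSyzygy P V) :
    ∃ (S : ShortComplex ℬ) (n : ℕ), S.ShortExact ∧ S.X₃ = V ∧ S.X₂ = P.X n ∧ IsSyzygy P S.X₁ ∧
      (S.map T).ShortExact := by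
  obtain ⟨n, p, w, hp, hw⟩ := hV
  have hS : (ShortComplex.mk (kernel.ι p) p (kernel.condition p)).ShortExact :=
    { exact := ShortComplex.exact_of_f_is_kernel _ (kernelIsKernel p) }
  let q : P.X (n + 1) ⟶ kernel p := kernel.lift p (P.d (n + 1) n) w
  have hqι : q ≫ kernel.ι p = P.d (n + 1) n := kernel.lift_ι _ _ _
  have hq : Epi q := hw.epi_kernelLift
  have wq : P.d (n + 2) (n + 1) ≫ q = 0 := by
    rw [← cancel_mono (kernel.ι p), Category.assoc, hqι, P.d_comp_d, zero_comp]
  have hwq : (ShortComplex.mk _ _ wq).Exact := by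
    rw [ShortComplex.exact_iff_exact_up_to_refinements]
    intro A x hx
    have hxq : x ≫ q = 0 := hx
    have hxd : x ≫ P.d (n + 1) n = 0 := by rw [← hqι, reassoc_of% hxq, zero_comp]
    exact (hP n).exact_up_to_refinements x hxd
  refine ⟨_, n, hS, rfl, rfl, ⟨n + 1, q, wq, hq, hwq⟩, ?_⟩
  have hTq : Epi (T.map q) := inferInstance
  have hmono : Mono (T.map (kernel.ι p)) := by
    refine Preadditive.mono_of_cancel_zero _ fun {A} x hx => ?_
    obtain ⟨A', π, _, y, hy⟩ := surjective_up_to_refinements_of_epi (T.map q) x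
    have hyd : y ≫ T.map (P.d (n + 1) n) = 0 := by
      rw [← hqι, T.map_comp, ← reassoc_of% hy, hx, comp_zero]
    obtain ⟨A'', π', _, z, hz⟩ : ∃ (A'' : 𝒜) (π' : A'' ⟶ A') (_ : Epi π')
        (z : A'' ⟶ T.obj (P.X (n + 2))), π' ≫ y = z ≫ T.map (P.d (n + 2) (n + 1)) :=
      (hTP n).exact_up_to_refinements y hyd
    rw [← cancel_epi π, ← cancel_epi π', hy, reassoc_of% hz, ← T.map_comp, wq]
    simp
  have hepi : Epi (T.map p) := inferInstance
  exact
    { exact := hS.exact.map_of_epi_of_preservesCokernel T hp inferInstance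
      mono_f := hmono
      epi_g := hepi }

end Syzygies

section CommaExact
variable {𝒜 : Type u} [Category.{v} 𝒜] [Abelian 𝒜]
  {ℬ : Type u'} [Category.{v'} ℬ] [Abelian ℬ] (T : ℬ ⥤ 𝒜)

/-- The functor `V ↦ (T V, V, 𝟙)`. -/
@[simps]
def commaFree : ℬ ⥤ Comma T (𝟭 𝒜) where
  obj V := { left := V, right := T.obj V, hom := 𝟙 _ }
  map f := { left := f, right := T.map f }

/-- The functor `V ↦ (T V, V, 𝟙)` is left adjoint to the first projection. -/
def commaFreeAdj : commaFree T ⊣ Comma.fst T (𝟭 𝒜) :=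
  Adjunction.mkOfHomEquiv
    { homEquiv V Z :=
        { toFun f := f.left
          invFun g :=
            { left := g
              right := T.map g ≫ Z.hom
              w := (Category.id_comp (T.map g ≫ Z.hom)).symm }
          left_inv f := by
            ext
            · rfl
            · exact f.w.trans (Category.id_comp f.right)
          right_inv _ := rfl }
      homEquiv_naturality_left_symm f g := by
        ext
        · rfl
        · exact (congrArg (· ≫ _) (T.map_comp f g)).trans (Category.assoc _ _ _) }

variable [T.Additive]

/-- The functor `A ↦ (A, 0, 0)`. -/
@[simps]
def commaRight : 𝒜 ⥤ Comma T (𝟭 𝒜) where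
  obj A := { left := 0, right := A, hom := 0 }
  map f := { left := 0, right := f }

lemma map_zero_obj_hom_ext {A : 𝒜} (f g : T.obj (0 : ℬ) ⟶ A) : f = g :=
  (T.map_isZero (isZero_zero ℬ)).eq_of_src _ _

/-- The functor `A ↦ (A, 0, 0)` is left adjoint to the second projection. -/
def commaRightAdj : commaRight T ⊣ Comma.snd T (𝟭 𝒜) :=
  Adjunction.mkOfHomEquiv
    { homEquiv A Z :=
        { toFun f := f.right
          invFun g := { left := 0, right := g, w := map_zero_obj_hom_ext T _ _ }
          left_inv f := by
            ext
            · exact (isZero_zero ℬ).eq_of_src _ _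
            · rfl
          right_inv _ := rfl }
      homEquiv_naturality_left_symm f g := by
        ext
        · exact (isZero_zero ℬ).eq_of_src _ _
        · rfl }

instance fst_preservesEpimorphisms : (Comma.fst T (𝟭 𝒜)).PreservesEpimorphisms where
  preserves {Z Z'} f hf := by
    refine Preadditive.epi_of_cancel_zero _ fun {B} g hg => ?_
    let Q : Comma T (𝟭 𝒜) := { left := B, right := 0, hom := 0 }
    let a : Z' ⟶ Q := { left := g, right := 0 }
    let b : Z' ⟶ Q := { left := 0, right := 0 }
    have hab : f ≫ a = f ≫ b := by
      ext
      exact hg.trans comp_zero.symm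
    exact congrArg CommaMorphism.left ((cancel_epi f).1 hab)

instance snd_preservesEpimorphisms [PreservesFiniteColimits T] :
    (Comma.snd T (𝟭 𝒜)).PreservesEpimorphisms where
  preserves {Z Z'} f hf := by
    refine Preadditive.epi_of_cancel_zero _ fun {A} g hg => ?_
    have : Epi f.left := inferInstanceAs (Epi ((Comma.fst T (𝟭 𝒜)).map f))
    have hg' : f.right ≫ g = 0 := hg
    have hw : Z'.hom ≫ g = 0 := by
      have := f.w
      dsimp at this
      rw [← cancel_epi (T.map f.left), reassoc_of% this, hg', comp_zero, comp_zero]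
    let Q : Comma T (𝟭 𝒜) := { left := 0, right := A, hom := 0 }
    let a : Z' ⟶ Q := { left := 0, right := g, w := by simp [Q, hw] }
    let b : Z' ⟶ Q := { left := 0, right := 0 }
    have hab : f ≫ a = f ≫ b := by
      ext
      exact hg'.trans comp_zero.symm
    exact congrArg CommaMorphism.right ((cancel_epi f).1 hab)

variable [h : Abelian (Comma T (𝟭 𝒜))]

/-- Zero morphisms in the comma category are taken with respect to its given abelian structure. -/
local instance commaPreadditive : Preadditive (Comma T (𝟭 𝒜)) := h.toPreadditive

local instance commaZero (Z Z' : Comma T (𝟭 𝒜)) : Zero (Z ⟶ Z') :=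
  Preadditive.preadditiveHasZeroMorphisms.zero Z Z'

lemma comma_zero_eq (Z Z' : Comma T (𝟭 𝒜)) :
    (0 : Z ⟶ Z') = { left := 0, right := 0 } := by
  let O : Comma T (𝟭 𝒜) := { left := 0, right := 0, hom := 0 }
  let a : Z ⟶ O := { left := 0, right := 0 }
  let b : O ⟶ Z' := { left := 0, right := 0, w := map_zero_obj_hom_ext T _ _ }
  have ha : a = 0 := by
    ext
  calc (0 : Z ⟶ Z') = a ≫ b := by rw [ha]; exact zero_comp.symm
    _ = _ := by
      ext
      · exact zero_comp
      · exact zero_comp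

@[simp]
lemma comma_zero_left (Z Z' : Comma T (𝟭 𝒜)) : (0 : Z ⟶ Z').left = 0 := by
  rw [comma_zero_eq]

@[simp]
lemma comma_zero_right (Z Z' : Comma T (𝟭 𝒜)) : (0 : Z ⟶ Z').right = 0 := by
  rw [comma_zero_eq]

/-- A short complex in the comma category is short exact if both of its components are. -/
lemma comma_shortExact [PreservesFiniteColimits T] (S : ShortComplex (Comma T (𝟭 𝒜)))
    (wl : S.f.left ≫ S.g.left = 0) (hl : (ShortComplex.mk _ _ wl).ShortExact)
    (wr : S.f.right ≫ S.g.right = 0) (hr : (ShortComplex.mk _ _ wr).ShortExact) :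
    S.ShortExact := by
  have : Mono S.f.left := hl.mono_f
  have : Mono S.f.right := hr.mono_f
  have : Epi S.g.left := hl.epi_g
  have : Epi S.g.right := hr.epi_g
  have hmono : Mono S.f := ⟨fun a b hab => by
    ext
    · rw [← cancel_mono S.f.left]
      exact congrArg CommaMorphism.left hab
    · rw [← cancel_mono S.f.right]
      exact congrArg CommaMorphism.right hab⟩
  have hepi : Epi S.g := ⟨fun a b hab => by
    ext
    · rw [← cancel_epi S.g.left]
      exact congrArg CommaMorphism.left hab
    · rw [← cancel_epi S.g.right]
      exact congrArg CommaMorphism.right hab⟩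
  have hdesc : ∀ {Z : Comma T (𝟭 𝒜)} (k : S.X₂ ⟶ Z), S.f ≫ k = 0 →
      ∃ l : S.X₃ ⟶ Z, S.g ≫ l = k := by
    intro Z k hk
    have hkl : S.f.left ≫ k.left = 0 := by simpa using congrArg CommaMorphism.left hk
    have hkr : S.f.right ≫ k.right = 0 := by simpa using congrArg CommaMorphism.right hk
    let l : S.X₃.left ⟶ Z.left := hl.exact.desc k.left hkl
    let r : S.X₃.right ⟶ Z.right := hr.exact.desc k.right hkr
    have hgl : S.g.left ≫ l = k.left := hl.exact.g_desc _ _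
    have hgr : S.g.right ≫ r = k.right := hr.exact.g_desc _ _
    refine ⟨{ left := l, right := r, w := ?_ }, ?_⟩
    · have hg := S.g.w
      have hk := k.w
      dsimp at hg hk ⊢
      rw [← cancel_epi (T.map S.g.left), ← Category.assoc, ← T.map_comp, hgl, hk,
        reassoc_of% hg, hgr]
    · ext
      · exact hgl
      · exact hgr
  have hexact : S.Exact := S.exact_of_g_is_cokernel
    (CokernelCofork.IsColimit.ofπ _ _ (fun k hk => (hdesc k hk).choose)
      (fun k hk => (hdesc k hk).choose_spec)
      (fun k hk m hm => by rw [← cancel_epi S.g, hm, (hdesc k hk).choose_spec]))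
  exact { exact := hexact }

instance commaFree_preservesZeroMorphisms : (commaFree T).PreservesZeroMorphisms where
  map_zero _ _ := by
    refine Eq.trans ?_ (comma_zero_eq T _ _).symm
    ext
    · rfl
    · exact T.map_zero _ _

instance commaRight_preservesZeroMorphisms : (commaRight T).PreservesZeroMorphisms where
  map_zero _ _ := by
    refine Eq.trans ?_ (comma_zero_eq T _ _).symm
    ext
    · rfl
    · rfl

variable [PreservesFiniteColimits T]

lemma shortExact_map_commaFree {S : ShortComplex ℬ} (hS : S.ShortExact)
    (hTS : (S.map T).ShortExact) : (S.map (commaFree T)).ShortExact :=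
  comma_shortExact T _ S.zero hS (S.map T).zero hTS

lemma shortExact_zero : (ShortComplex.mk (0 : (0 : ℬ) ⟶ 0) (0 : (0 : ℬ) ⟶ 0)
    zero_comp).ShortExact :=
  { exact := ShortComplex.exact_of_isZero_X₂ _ (isZero_zero ℬ)
    mono_f := ⟨fun _ _ _ => (isZero_zero ℬ).eq_of_tgt _ _⟩
    epi_g := ⟨fun _ _ _ => (isZero_zero ℬ).eq_of_src _ _⟩ }

lemma shortExact_map_commaRight {S : ShortComplex 𝒜} (hS : S.ShortExact) :
    (S.map (commaRight T)).ShortExact :=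
  comma_shortExact T _ zero_comp shortExact_zero S.zero hS

lemma exists_shortExact_of_mono_hom (W : Comma T (𝟭 𝒜)) [Mono W.hom] {C : 𝒜}
    (e : cokernel W.hom ≅ C) :
    ∃ S : ShortComplex (Comma T (𝟭 𝒜)), S.ShortExact ∧ S.X₁ = (commaFree T).obj W.left ∧
      S.X₂ = W ∧ S.X₃ = (commaRight T).obj C := by
  let f : (commaFree T).obj W.left ⟶ W := 
    { left := 𝟙 _
      right := W.hom
      w := congrArg (· ≫ W.hom) (T.map_id W.left) }
  let g : W ⟶ (commaRight T).obj C := 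
    { left := 0
      right := cokernel.π W.hom ≫ e.hom
      w := by
        change T.map 0 ≫ 0 = W.hom ≫ cokernel.π W.hom ≫ e.hom
        rw [comp_zero, cokernel.condition_assoc, zero_comp] }
  have wl : 𝟙 W.left ≫ (0 : W.left ⟶ (0 : ℬ)) = 0 := comp_zero
  have wr : W.hom ≫ cokernel.π W.hom ≫ e.hom = 0 := by
    rw [cokernel.condition_assoc, zero_comp]
  have w : f ≫ g = 0 := by
    refine Eq.trans ?_ (comma_zero_eq T _ _).symm
    ext
    · exact wl
    · exact wr
  have hl : (ShortComplex.mk _ _ wl).ShortExact :=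
    { exact := (ShortComplex.exact_iff_epi _ rfl).2 (inferInstanceAs (Epi (𝟙 W.left)))
      mono_f := inferInstanceAs (Mono (𝟙 W.left))
      epi_g := ⟨fun _ _ _ => (isZero_zero ℬ).eq_of_src _ _⟩ }
  have hr : (ShortComplex.mk _ _ wr).ShortExact :=
    { exact := ShortComplex.exact_of_g_is_cokernel _
        (CokernelCofork.IsColimit.ofπ _ _ (fun k hk => e.inv ≫ cokernel.desc W.hom k hk)
          (fun k hk => by simp)
          (fun k hk m hm => by
            rw [← cancel_epi (cokernel.π W.hom ≫ e.hom), hm]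
            simp)) }
  exact ⟨ShortComplex.mk f g w, comma_shortExact T _ wl hl wr hr, rfl, rfl, rfl⟩

variable [HasExt.{w₃} (Comma T (𝟭 𝒜))]

lemma subsingleton_ext_commaRight [EnoughProjectives 𝒜] [HasExt.{w₁} 𝒜] {A : 𝒜}
    (Z : Comma T (𝟭 𝒜))
    (hA : ∀ i : ℕ, 1 ≤ i → Subsingleton (Abelian.Ext A Z.right i)) {i : ℕ} (hi : 1 ≤ i) :
    Subsingleton (Abelian.Ext ((commaRight T).obj A) Z i) := by
  refine subsingleton_ext_of_adjunction (commaRightAdj T) (Q := fun _ => True)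
    (fun V _ => ?_) Z trivial hA hi
  have hS : (ShortComplex.mk (kernel.ι (Projective.π V)) (Projective.π V)
      (kernel.condition _)).ShortExact :=
    { exact := ShortComplex.exact_of_f_is_kernel _ (kernelIsKernel _) }
  exact ⟨_, hS, rfl, inferInstanceAs (Projective (Projective.over V)), trivial,
    shortExact_map_commaRight T hS⟩

lemma subsingleton_ext_commaFree [EnoughProjectives ℬ] [HasExt.{w₂} ℬ] {V : ℬ}
    (hT : ∀ n : ℕ, 1 ≤ n → IsZero ((T.leftDerived n).obj V)) (Z : Comma T (𝟭 𝒜))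
    (hV : ∀ i : ℕ, 1 ≤ i → Subsingleton (Abelian.Ext V Z.left i)) {i : ℕ} (hi : 1 ≤ i) :
    Subsingleton (Abelian.Ext ((commaFree T).obj V) Z i) := by
  let P := projectiveResolution V
  have hTP (n : ℕ) : ((P.complex.sc' (n + 2) (n + 1) n).map T).Exact := by
    have := (hT (n + 1) (by lia)).of_iso (P.isoLeftDerivedObj T (n + 1)).symm
    have hE : ((T.mapHomologicalComplex _).obj P.complex).ExactAt (n + 1) := by
      rw [HomologicalComplex.exactAt_iff_isZero_homology]
      exact this
    exact (HomologicalComplex.exactAt_iff' _ (n + 2) (n + 1) n (by simp) (by simp)).1 hE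
  refine subsingleton_ext_of_adjunction (commaFreeAdj T) (Q := IsSyzygy P.complex)
    (fun V' hV' => ?_) Z ⟨0, P.π.f 0, P.complex_d_comp_π_f_zero, inferInstance,
      ShortComplex.exact_of_g_is_cokernel _ P.isColimitCokernelCofork⟩ hV hi
  obtain ⟨S, n, hS, h₃, h₂, h₁, hTS⟩ := hV'.exists_shortExact T P.exact_succ hTP
  exact ⟨S, hS, h₃, h₂ ▸ P.projective n, h₁, shortExact_map_commaFree T hS hTS⟩

end CommaExact

end Paper

/-- under the hypotheses of Proposition 2.6,
`𝔅^𝒲_𝒱 ⊆ ^⊥(𝔅^𝒳_𝒴)` in the comma category `(T ↓ 𝒜)`. -/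
theorem statement7
    {𝒜 : Type u} [Category.{v} 𝒜] [Abelian 𝒜] [EnoughProjectives 𝒜] [EnoughInjectives 𝒜]
    {ℬ : Type u'} [Category.{v'} ℬ] [Abelian ℬ] [EnoughProjectives ℬ] [EnoughInjectives ℬ]
    (T : ℬ ⥤ 𝒜) [T.Additive] [PreservesFiniteColimits T]
    [Abelian (Comma T (𝟭 𝒜))]
    [HasExt.{w₁} 𝒜] [HasExt.{w₂} ℬ] [HasExt.{w₃} (Comma T (𝟭 𝒜))]
    (𝒳 𝒲 : Set 𝒜) (𝒴 𝒱 : Set ℬ)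
    (hA : IsStrongLeftFrobeniusPair 𝒳 𝒲) (hB : IsStrongLeftFrobeniusPair 𝒴 𝒱)
    (hV : ∀ V ∈ 𝒱, T.obj V ∈ Hat 𝒲)
    (hY : ∀ Y ∈ 𝒴, T.obj Y ∈ Hat 𝒳)
    (hLT : ∀ Y ∈ 𝒴, ∀ n : ℕ, 1 ≤ n → IsZero ((T.leftDerived n).obj Y))
    (W : Comma T (𝟭 𝒜)) (hW : W ∈ CommaClass T 𝒲 𝒱)
    (Z : Comma T (𝟭 𝒜)) (hZ : Z ∈ CommaClass T 𝒳 𝒴)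
    (i : ℕ) (hi : 1 ≤ i) :
    Subsingleton (Abelian.Ext.{w₃} W Z i) := by
  obtain ⟨hWl, hWm, C, hC, ⟨eC⟩⟩ := hW
  obtain ⟨hZl, hZm, X, hX, ⟨eX⟩⟩ := hZ
  obtain ⟨S, hS, h₁, rfl, h₃⟩ := exists_shortExact_of_mono_hom T W eC.symm
  refine subsingleton_ext_X₂ hS ?_ ?_
  · rw [h₁]
    exact subsingleton_ext_commaFree T (hLT _ (hB.W_subset_X hWl)) Z
      (hB.W_subset_leftPerp _ hWl _ hZl) hi
  · rw [h₃]
    refine subsingleton_ext_commaRight T Z (fun j hj => ?_) hi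
    have hT : (ShortComplex.mk Z.hom (cokernel.π Z.hom) (cokernel.condition _)).ShortExact :=
      { exact := ShortComplex.exact_cokernel _ }
    exact subsingleton_ext_to_X₂ hT
      (subsingleton_ext_of_mem_hat (hA.W_subset_leftPerp C hC) (hY _ hZl) hj)
      (subsingleton_ext_of_iso eX (hA.W_subset_leftPerp C hC X hX j hj))
end
end

section
/- Let 𝒜 be an abelian category with enough projectives and injectives and let (𝒳,𝒴) be a complete hereditary cotorsion pair in 𝒜. Then (𝒳, 𝒳 ∩ 𝒴) is a strong left Frobenius pair in 𝒜 if and only if (𝒳,𝒴) is a projective cotorsion pair. -/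
/-!
Formalization of a statement from "Recollements induced by left Frobenius pairs"
(Ma, Sun, Zhu, Hu). Auxiliary definitions (left Frobenius pairs, the classes
`𝒳̂` and `𝔅^𝒳_𝒴`, etc.) are given first; the statement itself is the final theorem.
-/

noncomputable section
namespace Paper
open CategoryTheory CategoryTheory.Limits ZeroObject

universe w₁ w₂ w₃ v v' u u'

section Cotorsion
variable {𝒜 : Type u} [Category.{v} 𝒜] [Abelian 𝒜] [HasExt.{w₁} 𝒜]

/-- `(𝒳, 𝒴)` is a cotorsion pair: each class is the `Ext¹`-orthogonal of the other. -/
structure IsCotorsionPair (𝒳 𝒴 : Set 𝒜) : Prop where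
  mem_left_iff : ∀ A : 𝒜, A ∈ 𝒳 ↔ ∀ Y ∈ 𝒴, Subsingleton (Abelian.Ext A Y 1)
  mem_right_iff : ∀ A : 𝒜, A ∈ 𝒴 ↔ ∀ X ∈ 𝒳, Subsingleton (Abelian.Ext X A 1)

/-- A complete cotorsion pair. -/
structure IsCompleteCotorsionPair (𝒳 𝒴 : Set 𝒜) extends IsCotorsionPair 𝒳 𝒴 : Prop where
  deres : ∀ A : 𝒜, ∃ S : ShortComplex 𝒜, S.ShortExact ∧ S.X₁ ∈ 𝒴 ∧ S.X₂ ∈ 𝒳 ∧ S.X₃ = A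
  cores : ∀ A : 𝒜, ∃ S : ShortComplex 𝒜, S.ShortExact ∧ S.X₁ = A ∧ S.X₂ ∈ 𝒴 ∧ S.X₃ ∈ 𝒳

/-- A complete hereditary cotorsion pair. -/
structure IsCompleteHereditaryCotorsionPair (𝒳 𝒴 : Set 𝒜)
    extends IsCompleteCotorsionPair 𝒳 𝒴 : Prop where
  hereditary : ∀ X ∈ 𝒳, ∀ Y ∈ 𝒴, ∀ i : ℕ, 1 ≤ i → Subsingleton (Abelian.Ext X Y i)

/-- A projective cotorsion pair: a complete cotorsion pair `(𝒳, 𝒴)` such that `𝒴` is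
thick and `𝒳 ∩ 𝒴` is exactly the class of projective objects. -/
structure IsProjectiveCotorsionPair (𝒳 𝒴 : Set 𝒜)
    extends IsCompleteCotorsionPair 𝒳 𝒴 : Prop where
  thick_summands : ∀ C A B : 𝒜, C ∈ 𝒴 → Nonempty (C ≅ A ⊞ B) → A ∈ 𝒴
  thick_two_of_three₁ : ∀ S : ShortComplex 𝒜, S.ShortExact → S.X₂ ∈ 𝒴 → S.X₃ ∈ 𝒴 → S.X₁ ∈ 𝒴
  thick_two_of_three₂ : ∀ S : ShortComplex 𝒜, S.ShortExact → S.X₁ ∈ 𝒴 → S.X₃ ∈ 𝒴 → S.X₂ ∈ 𝒴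
  thick_two_of_three₃ : ∀ S : ShortComplex 𝒜, S.ShortExact → S.X₁ ∈ 𝒴 → S.X₂ ∈ 𝒴 → S.X₃ ∈ 𝒴
  inter_eq_projectives : ∀ C : 𝒜, (C ∈ 𝒳 ∧ C ∈ 𝒴) ↔ Projective C

end Cotorsion

end Paper

open CategoryTheory CategoryTheory.Limits ZeroObject Paper

universe w₁ w₂ w₃ v v' u u'

namespace Paper

section ExtVanishing
variable {𝒜 : Type u} [Category.{v} 𝒜] [Abelian 𝒜] [HasExt.{w₁} 𝒜]

lemma subsingleton_ext_of_retract_left {A C Y : 𝒜} (r : Retract A C) (n : ℕ)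
    (hC : Subsingleton (Abelian.Ext C Y n)) : Subsingleton (Abelian.Ext A Y n) := by
  refine subsingleton_of_forall_eq 0 fun x ↦ ?_
  rw [← Abelian.Ext.mk₀_id_comp x, ← r.retract, ← Abelian.Ext.mk₀_comp_mk₀_assoc,
    Subsingleton.elim ((Abelian.Ext.mk₀ r.r).comp x (zero_add n)) 0, Abelian.Ext.comp_zero]

lemma subsingleton_ext_of_retract_right {A C X : 𝒜} (r : Retract A C) (n : ℕ)
    (hC : Subsingleton (Abelian.Ext X C n)) : Subsingleton (Abelian.Ext X A n) := by
  refine subsingleton_of_forall_eq 0 fun x ↦ ?_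
  rw [← Abelian.Ext.comp_mk₀_id x, ← r.retract, ← Abelian.Ext.mk₀_comp_mk₀,
    ← Abelian.Ext.comp_assoc_of_second_deg_zero,
    Subsingleton.elim (x.comp (Abelian.Ext.mk₀ r.i) (add_zero n)) 0, Abelian.Ext.zero_comp]

variable {S : ShortComplex 𝒜} (hS : S.ShortExact)
include hS

lemma subsingleton_ext_covariant₁ (X : 𝒜) (n : ℕ)
    (h₃ : Subsingleton (Abelian.Ext X S.X₃ n)) (h₂ : Subsingleton (Abelian.Ext X S.X₂ (n + 1))) :
    Subsingleton (Abelian.Ext X S.X₁ (n + 1)) := by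
  refine subsingleton_of_forall_eq 0 fun x ↦ ?_
  obtain ⟨y, rfl⟩ := Abelian.Ext.covariant_sequence_exact₁ X hS x (Subsingleton.elim _ _) rfl
  rw [Subsingleton.elim y 0, Abelian.Ext.zero_comp]

lemma subsingleton_ext_covariant₂ (X : 𝒜) (n : ℕ)
    (h₁ : Subsingleton (Abelian.Ext X S.X₁ n)) (h₃ : Subsingleton (Abelian.Ext X S.X₃ n)) :
    Subsingleton (Abelian.Ext X S.X₂ n) := by
  refine subsingleton_of_forall_eq 0 fun x ↦ ?_
  obtain ⟨y, rfl⟩ := Abelian.Ext.covariant_sequence_exact₂ X hS x (Subsingleton.elim _ _)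
  rw [Subsingleton.elim y 0, Abelian.Ext.zero_comp]

lemma subsingleton_ext_covariant₃ (X : 𝒜) (n : ℕ)
    (h₂ : Subsingleton (Abelian.Ext X S.X₂ n)) (h₁ : Subsingleton (Abelian.Ext X S.X₁ (n + 1))) :
    Subsingleton (Abelian.Ext X S.X₃ n) := by
  refine subsingleton_of_forall_eq 0 fun x ↦ ?_
  obtain ⟨y, rfl⟩ := Abelian.Ext.covariant_sequence_exact₃ X hS x rfl (Subsingleton.elim _ _)
  rw [Subsingleton.elim y 0, Abelian.Ext.zero_comp]

lemma subsingleton_ext_contravariant₁ (Y : 𝒜) (n : ℕ)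
    (h₂ : Subsingleton (Abelian.Ext S.X₂ Y n)) (h₃ : Subsingleton (Abelian.Ext S.X₃ Y (n + 1))) :
    Subsingleton (Abelian.Ext S.X₁ Y n) := by
  refine subsingleton_of_forall_eq 0 fun x ↦ ?_
  obtain ⟨y, rfl⟩ :=
    Abelian.Ext.contravariant_sequence_exact₁ hS Y x (add_comm 1 n) (Subsingleton.elim _ _)
  rw [Subsingleton.elim y 0, Abelian.Ext.comp_zero]

lemma subsingleton_ext_contravariant₂ (Y : 𝒜) (n : ℕ)
    (h₁ : Subsingleton (Abelian.Ext S.X₁ Y n)) (h₃ : Subsingleton (Abelian.Ext S.X₃ Y n)) :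
    Subsingleton (Abelian.Ext S.X₂ Y n) := by
  refine subsingleton_of_forall_eq 0 fun x ↦ ?_
  obtain ⟨y, rfl⟩ := Abelian.Ext.contravariant_sequence_exact₂ hS Y x (Subsingleton.elim _ _)
  rw [Subsingleton.elim y 0, Abelian.Ext.comp_zero]

end ExtVanishing

section CotorsionClosure
variable {𝒜 : Type u} [Category.{v} 𝒜] [Abelian 𝒜]

/-- A direct summand, presented by an isomorphism with a biproduct, is a retract. -/
def retractOfIsoBiprod {A B C : 𝒜} (e : C ≅ A ⊞ B) : Retract A C where
  i := biprod.inl ≫ e.inv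
  r := e.hom ≫ biprod.fst

variable [HasExt.{w₁} 𝒜] {𝒳 𝒴 : Set 𝒜}

lemma IsCotorsionPair.left_of_retract (h : IsCotorsionPair 𝒳 𝒴) {A C : 𝒜} (r : Retract A C)
    (hC : C ∈ 𝒳) : A ∈ 𝒳 :=
  (h.mem_left_iff A).2 fun Y hY ↦
    subsingleton_ext_of_retract_left r 1 ((h.mem_left_iff C).1 hC Y hY)

lemma IsCotorsionPair.right_of_retract (h : IsCotorsionPair 𝒳 𝒴) {A C : 𝒜} (r : Retract A C)
    (hC : C ∈ 𝒴) : A ∈ 𝒴 :=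
  (h.mem_right_iff A).2 fun X hX ↦
    subsingleton_ext_of_retract_right r 1 ((h.mem_right_iff C).1 hC X hX)

lemma IsCotorsionPair.left_of_extension (h : IsCotorsionPair 𝒳 𝒴) {S : ShortComplex 𝒜}
    (hS : S.ShortExact) (h₁ : S.X₁ ∈ 𝒳) (h₃ : S.X₃ ∈ 𝒳) : S.X₂ ∈ 𝒳 :=
  (h.mem_left_iff _).2 fun Y hY ↦ subsingleton_ext_contravariant₂ hS Y 1
    ((h.mem_left_iff _).1 h₁ Y hY) ((h.mem_left_iff _).1 h₃ Y hY)

lemma IsCotorsionPair.right_of_extension (h : IsCotorsionPair 𝒳 𝒴) {S : ShortComplex 𝒜}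
    (hS : S.ShortExact) (h₁ : S.X₁ ∈ 𝒴) (h₃ : S.X₃ ∈ 𝒴) : S.X₂ ∈ 𝒴 :=
  (h.mem_right_iff _).2 fun X hX ↦ subsingleton_ext_covariant₂ hS X 1
    ((h.mem_right_iff _).1 h₁ X hX) ((h.mem_right_iff _).1 h₃ X hX)

lemma IsCotorsionPair.left_of_projective (h : IsCotorsionPair 𝒳 𝒴) (P : 𝒜) [Projective P] :
    P ∈ 𝒳 :=
  (h.mem_left_iff P).2 fun _ _ ↦ subsingleton_of_forall_eq 0 Abelian.Ext.eq_zero_of_projective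

lemma IsCompleteHereditaryCotorsionPair.left_of_kernel_of_epi
    (h : IsCompleteHereditaryCotorsionPair 𝒳 𝒴) {S : ShortComplex 𝒜}
    (hS : S.ShortExact) (h₂ : S.X₂ ∈ 𝒳) (h₃ : S.X₃ ∈ 𝒳) : S.X₁ ∈ 𝒳 :=
  (h.mem_left_iff _).2 fun Y hY ↦ subsingleton_ext_contravariant₁ hS Y 1
    ((h.mem_left_iff _).1 h₂ Y hY) (h.hereditary _ h₃ Y hY 2 (by lia))

lemma IsCompleteHereditaryCotorsionPair.right_of_cokernel_of_mono
    (h : IsCompleteHereditaryCotorsionPair 𝒳 𝒴) {S : ShortComplex 𝒜}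
    (hS : S.ShortExact) (h₁ : S.X₁ ∈ 𝒴) (h₂ : S.X₂ ∈ 𝒴) : S.X₃ ∈ 𝒴 :=
  (h.mem_right_iff _).2 fun X hX ↦ subsingleton_ext_covariant₃ hS X 1
    ((h.mem_right_iff _).1 h₂ X hX) (h.hereditary X hX _ h₁ 2 (by lia))

lemma IsCompleteHereditaryCotorsionPair.isStrongLeftFrobeniusPair [EnoughProjectives 𝒜]
    (h : IsCompleteHereditaryCotorsionPair 𝒳 𝒴) (hp : IsProjectiveCotorsionPair 𝒳 𝒴) :
    IsStrongLeftFrobeniusPair 𝒳 (𝒳 ∩ 𝒴) where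
  closed_extensions _ hS h₁ h₃ := h.left_of_extension hS h₁ h₃
  closed_kernels_of_epis _ hS h₂ h₃ := h.left_of_kernel_of_epi hS h₂ h₃
  closed_summands_X _ _ _ hC := fun ⟨e⟩ ↦ h.left_of_retract (retractOfIsoBiprod e) hC
  closed_summands_W _ _ _ hC := fun ⟨e⟩ ↦
    ⟨h.left_of_retract (retractOfIsoBiprod e) hC.1,
      h.right_of_retract (retractOfIsoBiprod e) hC.2⟩
  W_subset_X := Set.inter_subset_left
  W_subset_rightPerp W hW X hX i hi := h.hereditary X hX W hW.2 i hi
  cogenerator X hX := by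
    obtain ⟨S, hS, rfl, h₂, h₃⟩ := h.cores X
    exact ⟨S, hS, rfl, ⟨h.left_of_extension hS hX h₃, h₂⟩, h₃⟩
  W_subset_leftPerp W hW X _ i hi := by
    have : Projective W := (hp.inter_eq_projectives W).1 hW
    obtain ⟨n, rfl⟩ := Nat.exists_eq_add_of_le' hi
    exact subsingleton_of_forall_eq 0 Abelian.Ext.eq_zero_of_projective
  generator X hX := by
    have hS : (ShortComplex.mk (kernel.ι (Projective.π X)) (Projective.π X)
        (kernel.condition _)).ShortExact :=
      { exact := ShortComplex.exact_kernel _ }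
    have hW := (hp.inter_eq_projectives (Projective.over X)).2 inferInstance
    exact ⟨_, hS, rfl, hW, h.left_of_kernel_of_epi hS hW.1 hX⟩

lemma IsCompleteHereditaryCotorsionPair.inter_eq_projectives
    (h : IsCompleteHereditaryCotorsionPair 𝒳 𝒴)
    (hF : IsStrongLeftFrobeniusPair 𝒳 (𝒳 ∩ 𝒴)) (C : 𝒜) :
    (C ∈ 𝒳 ∧ C ∈ 𝒴) ↔ Projective C := by
  refine ⟨fun hC ↦ projective_iff_subsingleton_ext_one.2 fun {A} ↦ ?_, fun hC ↦ ?_⟩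
  · obtain ⟨S, hS, h₁, h₂, rfl⟩ := h.deres A
    exact subsingleton_ext_covariant₃ hS C 1 (hF.W_subset_leftPerp C hC _ h₂ 1 le_rfl)
      (h.hereditary C hC.1 _ h₁ 2 (by lia))
  · have hX := h.left_of_projective C
    obtain ⟨S, hS, rfl, h₂, -⟩ := hF.generator C hX
    have := hS.epi_g
    let r : Retract S.X₃ S.X₂ :=
      { i := Projective.factorThru (𝟙 S.X₃) S.g
        r := S.g }
    exact ⟨hX, h.right_of_retract r h₂.2⟩

lemma IsCompleteHereditaryCotorsionPair.right_of_kernel_of_epi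
    (h : IsCompleteHereditaryCotorsionPair 𝒳 𝒴)
    (hF : IsStrongLeftFrobeniusPair 𝒳 (𝒳 ∩ 𝒴)) {S : ShortComplex 𝒜}
    (hS : S.ShortExact) (h₂ : S.X₂ ∈ 𝒴) (h₃ : S.X₃ ∈ 𝒴) : S.X₁ ∈ 𝒴 := by
  have ext_two : ∀ X ∈ 𝒳, Subsingleton (Abelian.Ext X S.X₁ 2) := fun X hX ↦
    subsingleton_ext_covariant₁ hS X 1 ((h.mem_right_iff _).1 h₃ X hX)
      (h.hereditary X hX _ h₂ 2 (by lia))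
  refine (h.mem_right_iff _).2 fun X hX ↦ ?_
  obtain ⟨T, hT, rfl, hW, hX'⟩ := hF.cogenerator X hX
  have : Projective T.X₂ := (h.inter_eq_projectives hF _).1 hW
  exact subsingleton_ext_contravariant₁ hT _ 1
    (subsingleton_of_forall_eq 0 Abelian.Ext.eq_zero_of_projective) (ext_two _ hX')

lemma IsCompleteHereditaryCotorsionPair.isProjectiveCotorsionPair
    (h : IsCompleteHereditaryCotorsionPair 𝒳 𝒴)
    (hF : IsStrongLeftFrobeniusPair 𝒳 (𝒳 ∩ 𝒴)) :
    IsProjectiveCotorsionPair 𝒳 𝒴 where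
  toIsCompleteCotorsionPair := h.toIsCompleteCotorsionPair
  thick_summands _ _ _ hC := fun ⟨e⟩ ↦ h.right_of_retract (retractOfIsoBiprod e) hC
  thick_two_of_three₁ _ hS h₂ h₃ := h.right_of_kernel_of_epi hF hS h₂ h₃
  thick_two_of_three₂ _ hS h₁ h₃ := h.right_of_extension hS h₁ h₃
  thick_two_of_three₃ _ hS h₁ h₂ := h.right_of_cokernel_of_mono hS h₁ h₂
  inter_eq_projectives := h.inter_eq_projectives hF

end CotorsionClosure

end Paper

/-- Lemma 4.1(2): if `(𝒳,𝒴)` is a complete hereditary cotorsion pair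
in `𝒜`, then `(𝒳, 𝒳 ∩ 𝒴)` is a strong left Frobenius pair iff `(𝒳,𝒴)` is a projective
cotorsion pair. -/
theorem statement10
    {𝒜 : Type u} [Category.{v} 𝒜] [Abelian 𝒜] [EnoughProjectives 𝒜] [EnoughInjectives 𝒜]
    [HasExt.{w₁} 𝒜]
    (𝒳 𝒴 : Set 𝒜) (h : IsCompleteHereditaryCotorsionPair 𝒳 𝒴) :
    IsStrongLeftFrobeniusPair 𝒳 (𝒳 ∩ 𝒴) ↔ IsProjectiveCotorsionPair 𝒳 𝒴 :=
  ⟨h.isProjectiveCotorsionPair, h.isStrongLeftFrobeniusPair⟩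
end
end
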